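/- Let ε > 0 and let (a_k)_{k≥0} be a sequence in ℝ^d with δ_k := ‖a_k − a⋆‖, such that ‖a_{k+1} − (a_k − (H_F(a_k))⁻¹ g_F(a_k))‖ ≤ ε for all k. Let n ≥ 1 and suppose δ_k ≥ √(2με/M) for every k ∈ {0, 1, ..., n−1}. Then δ_n ≤ (μ/M) (M δ_0 / μ)^{2^n}. -/

import Mathlib

open scoped RealInnerProductSpace

/-- Second-order Taylor bound for a map with Lipschitz derivative. -/
theorem norm_taylor_remainder_le_of_lipschitz_fderiv {E G : Type*}
    [NormedAddCommGroup E] [NormedSpace ℝ E] [NormedAddCommGroup G] [NormedSpace ℝ G]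
    {g : E → G} {H : E → E →L[ℝ] G} {M : ℝ} (hH : ∀ x, HasFDerivAt g (H x) x)
    (hLip : ∀ x y, ‖H x - H y‖ ≤ M * ‖x - y‖) (x v : E) :
    ‖g (x + v) - g x - H x v‖ ≤ M / 2 * ‖v‖ ^ 2 := by
  have hφ (t : ℝ) : HasDerivAt (fun s : ℝ => g (x + s • v) - g x - s • H x v)
      (H (x + t • v) v - H x v) t := by
    have hl : HasDerivAt (fun s : ℝ => x + s • v) v t := by
      simpa using ((hasDerivAt_id t).smul_const v).const_add x
    have hs : HasDerivAt (fun s : ℝ => s • H x v) (H x v) t := by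
      simpa using (hasDerivAt_id t).smul_const (H x v)
    exact (((hH (x + t • v)).comp_hasDerivAt t hl).sub_const (g x)).sub hs
  have hB (t : ℝ) : HasDerivAt (fun s : ℝ => M / 2 * ‖v‖ ^ 2 * s ^ 2) (M * ‖v‖ ^ 2 * t) t := by
    refine ((hasDerivAt_pow 2 t).const_mul (M / 2 * ‖v‖ ^ 2)).congr_deriv ?_
    norm_num
    ring
  have key := image_norm_le_of_norm_deriv_right_le_deriv_boundary (a := 0) (b := 1)
    (fun t _ => (hφ t).continuousAt.continuousWithinAt)
    (fun t _ => (hφ t).hasDerivWithinAt) (by simp) hB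
    (fun t ht => by
      calc ‖H (x + t • v) v - H x v‖ = ‖(H (x + t • v) - H x) v‖ := by simp
        _ ≤ ‖H (x + t • v) - H x‖ * ‖v‖ := ContinuousLinearMap.le_opNorm _ _
        _ ≤ M * ‖x + t • v - x‖ * ‖v‖ := by gcongr; exact hLip _ _
        _ = M * ‖v‖ ^ 2 * t := by
          rw [add_sub_cancel_left, norm_smul, Real.norm_of_nonneg ht.1]
          ring)
    (Set.right_mem_Icc.2 zero_le_one)
  simpa using key

/-- The derivative of a strongly monotone map is coercive. -/
theorem le_inner_fderiv_of_strongly_monotone {E : Type*}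
    [NormedAddCommGroup E] [InnerProductSpace ℝ E] {g : E → E} {μ : ℝ}
    (hg : ∀ x y, μ * ‖x - y‖ ^ 2 ≤ ⟪g x - g y, x - y⟫)
    {x : E} {A : E →L[ℝ] E} (hA : HasFDerivAt g A x) (v : E) :
    μ * ‖v‖ ^ 2 ≤ ⟪A v, v⟫ := by
  have hmono : Monotone fun t : ℝ => ⟪g (x + t • v), v⟫ - t * (μ * ‖v‖ ^ 2) := by
    intro s t hst
    rcases hst.eq_or_lt with rfl | hst
    · exact le_rfl
    have h := hg (x + t • v) (x + s • v)
    rw [add_sub_add_left_eq_sub, ← sub_smul, norm_smul, inner_smul_right, inner_sub_left,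
      mul_pow, Real.norm_eq_abs, sq_abs] at h
    have hpos : 0 < t - s := sub_pos.2 hst
    have : (t - s) * (μ * ‖v‖ ^ 2) ≤ ⟪g (x + t • v), v⟫ - ⟪g (x + s • v), v⟫ := by
      refine le_of_mul_le_mul_left ?_ hpos
      linarith
    dsimp only
    linarith
  have hl : HasDerivAt (fun s : ℝ => x + s • v) v 0 := by
    simpa using ((hasDerivAt_id (0 : ℝ)).smul_const v).const_add x
  have hA' : HasFDerivAt g A (x + (0 : ℝ) • v) := by simpa using hA
  have hd := ((hA'.comp_hasDerivAt 0 hl).inner ℝ (hasDerivAt_const 0 v)).sub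
    ((hasDerivAt_id (0 : ℝ)).mul_const (μ * ‖v‖ ^ 2))
  have h0 := hd.nonneg_of_monotone hmono
  simp only [inner_zero_right, zero_add, one_mul] at h0
  linarith

/-- A coercive operator is bounded below. -/
theorem mul_norm_le_norm_apply_of_coercive {E : Type*}
    [NormedAddCommGroup E] [InnerProductSpace ℝ E] {μ : ℝ} {A : E →L[ℝ] E}
    (hA : ∀ v, μ * ‖v‖ ^ 2 ≤ ⟪A v, v⟫) (v : E) : μ * ‖v‖ ≤ ‖A v‖ := by
  rcases eq_or_ne v 0 with rfl | hv
  · simp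
  · refine le_of_mul_le_mul_right ?_ (norm_pos_iff.2 hv)
    linarith [hA v, real_inner_le_norm (A v) v]

/-- The error of an exact Newton step for a zero of a strongly monotone map. -/
theorem norm_newton_step_sub_le {E : Type*}
    [NormedAddCommGroup E] [InnerProductSpace ℝ E] [FiniteDimensional ℝ E]
    {g : E → E} {H : E → E →L[ℝ] E} {μ M : ℝ} (hμ : 0 < μ)
    (hg : ∀ x y, μ * ‖x - y‖ ^ 2 ≤ ⟪g x - g y, x - y⟫)
    (hH : ∀ x, HasFDerivAt g (H x) x)
    (hLip : ∀ x y, ‖H x - H y‖ ≤ M * ‖x - y‖) {z : E} (hz : g z = 0) (x : E) :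
    ‖x - (H x).inverse (g x) - z‖ ≤ M / (2 * μ) * ‖x - z‖ ^ 2 := by
  have hlow := mul_norm_le_norm_apply_of_coercive (le_inner_fderiv_of_strongly_monotone hg (hH x))
  have hinj : Function.Injective (H x) := by
    refine (injective_iff_map_eq_zero (H x)).2 fun v hv => norm_le_zero_iff.1 ?_
    have h := hlow v
    rw [hv, norm_zero] at h
    exact nonpos_of_mul_nonpos_right h hμ
  let e : E ≃L[ℝ] E :=
    (LinearEquiv.ofInjectiveEndo (H x : E →ₗ[ℝ] E) hinj).toContinuousLinearEquiv
  have he : (e : E →L[ℝ] E) = H x := by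
    ext v
    rfl
  have hinv : H x ((H x).inverse (g x)) = g x := by
    rw [← he, ContinuousLinearMap.inverse_equiv]
    exact e.apply_symm_apply _
  have htaylor := norm_taylor_remainder_le_of_lipschitz_fderiv hH hLip x (z - x)
  have heq : H x (x - (H x).inverse (g x) - z) = g (x + (z - x)) - g x - H x (z - x) := by
    rw [add_sub_cancel, hz]
    simp only [map_sub, hinv]
    abel
  have h := hlow (x - (H x).inverse (g x) - z)
  rw [heq] at h
  rw [norm_sub_rev z x] at htaylor
  calc ‖x - (H x).inverse (g x) - z‖ ≤ M / 2 * ‖x - z‖ ^ 2 / μ := by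
        rw [le_div_iff₀ hμ]
        linarith
    _ = M / (2 * μ) * ‖x - z‖ ^ 2 := by field_simp

/-- Quadratic-convergence phase: if each of the first `n`
iterates of an `ε`-approximate Newton iteration stays at distance at least
`√(2με/M)` from `a⋆`, then `δ_n ≤ (μ/M)(Mδ₀/μ)^{2^n}`. -/
theorem stmt14 (d : ℕ) (hd : 1 ≤ d)
    (F : EuclideanSpace ℝ (Fin d) → ℝ) (hF : ContDiff ℝ 2 F)
    (μ M : ℝ) (hμ : 0 < μ) (hM : 0 < M)
    (hconv : ∀ a b : EuclideanSpace ℝ (Fin d),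
      F a ≥ F b + ⟪gradient F b, a - b⟫ + μ / 2 * ‖a - b‖ ^ 2)
    (H : EuclideanSpace ℝ (Fin d) →
      (EuclideanSpace ℝ (Fin d) →L[ℝ] EuclideanSpace ℝ (Fin d)))
    (hH : ∀ x, HasFDerivAt (gradient F) (H x) x)
    (hLip : ∀ a b : EuclideanSpace ℝ (Fin d), ‖H a - H b‖ ≤ M * ‖a - b‖)
    (astar : EuclideanSpace ℝ (Fin d)) (hmin : ∀ x, F astar ≤ F x)
    (hmin_unique : ∀ b, (∀ x, F b ≤ F x) → b = astar)
    (ε : ℝ) (hε : 0 < ε)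
    (a : ℕ → EuclideanSpace ℝ (Fin d))
    (hupd : ∀ k : ℕ,
      ‖a (k + 1) - (a k - (H (a k)).inverse (gradient F (a k)))‖ ≤ ε)
    (n : ℕ) (hn : 1 ≤ n)
    (hfar : ∀ k < n, Real.sqrt (2 * μ * ε / M) ≤ ‖a k - astar‖) :
    ‖a n - astar‖ ≤ μ / M * (M * ‖a 0 - astar‖ / μ) ^ (2 ^ n) := by
  have hmono (x y : EuclideanSpace ℝ (Fin d)) :
      μ * ‖x - y‖ ^ 2 ≤ ⟪gradient F x - gradient F y, x - y⟫ := by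
    have h₁ := hconv x y
    have h₂ := hconv y x
    rw [norm_sub_rev y x, ← neg_sub x y, inner_neg_right] at h₂
    rw [inner_sub_left]
    linarith
  have hcrit : gradient F astar = 0 := by
    have hloc : IsLocalMin F astar := Filter.Eventually.of_forall hmin
    rw [gradient, hloc.fderiv_eq_zero, map_zero]
  have hstep (k : ℕ) (hk : k < n) :
      ‖a (k + 1) - astar‖ ≤ M / μ * ‖a k - astar‖ ^ 2 := by
    have hnewton := norm_newton_step_sub_le hμ hmono hH hLip hcrit (a k)
    have hε' : ε ≤ M / (2 * μ) * ‖a k - astar‖ ^ 2 := by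
      have h := (Real.sqrt_le_left (norm_nonneg _)).1 (hfar k hk)
      calc ε = M / (2 * μ) * (2 * μ * ε / M) := by field_simp
        _ ≤ M / (2 * μ) * ‖a k - astar‖ ^ 2 := by gcongr
    calc ‖a (k + 1) - astar‖
        ≤ ‖a (k + 1) - (a k - (H (a k)).inverse (gradient F (a k)))‖
          + ‖a k - (H (a k)).inverse (gradient F (a k)) - astar‖ :=
          norm_sub_le_norm_sub_add_norm_sub _ _ _
      _ ≤ M / (2 * μ) * ‖a k - astar‖ ^ 2 + M / (2 * μ) * ‖a k - astar‖ ^ 2 :=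
          add_le_add ((hupd k).trans hε') hnewton
      _ = M / μ * ‖a k - astar‖ ^ 2 := by field_simp; ring
  have hbound : ∀ k ≤ n, ‖a k - astar‖ ≤ μ / M * (M * ‖a 0 - astar‖ / μ) ^ (2 ^ k) := by
    intro k
    induction k with
    | zero =>
      intro _
      refine le_of_eq ?_
      rw [pow_zero, pow_one]
      field_simp
    | succ k ih =>
      intro hk
      calc ‖a (k + 1) - astar‖ ≤ M / μ * ‖a k - astar‖ ^ 2 := hstep k hk
        _ ≤ M / μ * (μ / M * (M * ‖a 0 - astar‖ / μ) ^ (2 ^ k)) ^ 2 := by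
          gcongr
          exact ih (Nat.le_of_succ_le hk)
        _ = μ / M * (M * ‖a 0 - astar‖ / μ) ^ (2 ^ (k + 1)) := by
          rw [pow_succ 2 k, pow_mul, mul_pow (μ / M)]
          field_simp
  exact hbound n le_rfl
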